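/- arXiv:1705.01805 — 2 statements merged into one kernel-verified Lean document; each statement's English description precedes it below -/
import Mathlib

section
/- For each positive integer k, the set A_k = {n ≥ 1 : gcd(n, F_n) = k} has an asymptotic density; that is, the limit as x → ∞ of #(A_k ∩ [1, x]) / x exists. -/
open scoped BigOperators

/-- `fibZ m` is the rank of appearance of `m`: the least positive `n` with `m ∣ F_n`. -/
noncomputable def fibZ (m : ℕ) : ℕ := sInf {n : ℕ | 0 < n ∧ m ∣ Nat.fib n}

/-- `fibL m = lcm(m, z(m))`. -/
noncomputable def fibL (m : ℕ) : ℕ := Nat.lcm m (fibZ m)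

/-- `countIn S x` is the number of elements of `S` in `[1, x]`. -/
noncomputable def countIn (S : Set ℕ) (x : ℝ) : ℕ :=
  (S ∩ {n : ℕ | 1 ≤ n ∧ (n : ℝ) ≤ x}).ncard

/-- `S` has asymptotic density `a`. -/
def HasDensity (S : Set ℕ) (a : ℝ) : Prop :=
  Filter.Tendsto (fun x : ℝ => (countIn S x : ℝ) / x) Filter.atTop (nhds a)

/-- `fibA k` is the set of positive integers `n` with `gcd(n, F_n) = k`. -/
def fibA (k : ℕ) : Set ℕ := {n : ℕ | 0 < n ∧ Nat.gcd n (Nat.fib n) = k}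

/-! ### The rank of appearance -/

theorem fibZ_spec {d n : ℕ} (hn : 0 < n) (h : d ∣ Nat.fib n) :
    0 < fibZ d ∧ d ∣ Nat.fib (fibZ d) :=
  Nat.sInf_mem (s := {n : ℕ | 0 < n ∧ d ∣ Nat.fib n}) ⟨n, hn, h⟩

theorem fibZ_le {d n : ℕ} (hn : 0 < n) (h : d ∣ Nat.fib n) : fibZ d ≤ n :=
  Nat.sInf_le (s := {n : ℕ | 0 < n ∧ d ∣ Nat.fib n}) ⟨hn, h⟩

theorem fibZ_dvd {d n : ℕ} (hn : 0 < n) (h : d ∣ Nat.fib n) : fibZ d ∣ n := by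
  obtain ⟨hz, hd⟩ := fibZ_spec hn h
  have hg : d ∣ Nat.fib (Nat.gcd (fibZ d) n) := by
    rw [Nat.fib_gcd]
    exact Nat.dvd_gcd hd h
  have hle := fibZ_le (Nat.gcd_pos_of_pos_left n hz) hg
  have heq : Nat.gcd (fibZ d) n = fibZ d :=
    le_antisymm (Nat.gcd_le_left n hz) hle
  exact Nat.gcd_eq_left_iff_dvd.mp heq

/-- For a prime `p ≠ 5`, divisibility of `F_{pm}` by `p` descends to `F_m`. -/
theorem prime_dvd_fib_of_dvd_fib_mul {p m : ℕ} (hp : p.Prime) (h5 : p ≠ 5)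
    (h : p ∣ Nat.fib (p * m)) : p ∣ Nat.fib m := by
  have : Fact p.Prime := ⟨hp⟩
  let K := AlgebraicClosure (ZMod p)
  have : CharP K p := charP_of_injective_algebraMap (algebraMap (ZMod p) K).injective p
  obtain ⟨a, ha⟩ : ∃ a : K, a ^ 2 = a + 1 := by
    have hdeg : (Polynomial.X ^ 2 - Polynomial.X - 1 : Polynomial K).degree ≠ 0 := by
      have : (Polynomial.X ^ 2 - Polynomial.X - 1 : Polynomial K).degree = 2 := by
        compute_degree!
      rw [this]
      decide
    obtain ⟨a, ha⟩ := IsAlgClosed.exists_root _ hdeg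
    refine ⟨a, ?_⟩
    simp only [Polynomial.IsRoot, Polynomial.eval_sub, Polynomial.eval_pow, Polynomial.eval_X,
      Polynomial.eval_one] at ha
    linear_combination ha
  have hb : (1 - a) ^ 2 = (1 - a) + 1 := by linear_combination ha
  have binet : ∀ n : ℕ, (Nat.fib n : K) * (2 * a - 1) = a ^ n - (1 - a) ^ n := by
    intro n
    induction n using Nat.twoStepInduction with
    | zero => simp
    | one => simp; ring
    | more n h1 h2 =>
      rw [Nat.fib_add_two]
      push_cast
      linear_combination h1 + h2 - a ^ n * ha + (1 - a) ^ n * hb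
  have hsq : (2 * a - 1) ^ 2 = ((5 : ℕ) : K) := by
    push_cast
    linear_combination 4 * ha
  have hne : 2 * a - 1 ≠ 0 := by
    intro h0
    rw [h0] at hsq
    have h50 : ((5 : ℕ) : K) = 0 := by rw [← hsq]; simp
    rw [CharP.cast_eq_zero_iff K p] at h50
    exact h5 ((Nat.prime_dvd_prime_iff_eq hp (by norm_num)).mp h50)
  have h0 : (a ^ m - (1 - a) ^ m) ^ p = 0 := by
    rw [sub_pow_char, ← pow_mul, ← pow_mul, mul_comm m p, ← binet,
      (CharP.cast_eq_zero_iff K p _).mpr h, zero_mul]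
  have h1 := pow_eq_zero_iff hp.ne_zero |>.mp h0
  rw [← binet, mul_eq_zero, or_iff_left hne] at h1
  exact (CharP.cast_eq_zero_iff K p _).mp h1

theorem mul_fibZ_dvd {p n : ℕ} (hp : p.Prime) (h5 : p ≠ 5) (hn : 0 < n) (hpn : p ∣ n)
    (h : p ∣ Nat.fib n) : p * fibZ p ∣ n := by
  refine Nat.Coprime.mul_dvd_of_dvd_of_dvd ?_ hpn (fibZ_dvd hn h)
  rw [hp.coprime_iff_not_dvd]
  rintro ⟨m, hm⟩
  obtain ⟨hz, hd⟩ := fibZ_spec hn h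
  have hm0 : 0 < m := by
    rcases Nat.eq_zero_or_pos m with rfl | h0
    · omega
    · exact h0
  rw [hm] at hd
  have hle := fibZ_le hm0 (prime_dvd_fib_of_dvd_fib_mul hp h5 hd)
  have := hp.two_le
  nlinarith

/-! ### Summability of `1 / (p z(p))` -/

theorem fib_le_two_pow (n : ℕ) : Nat.fib n ≤ 2 ^ n := by
  induction n using Nat.twoStepInduction with
  | zero => simp
  | one => simp
  | more n h1 h2 =>
    rw [Nat.fib_add_two]
    rw [pow_succ] at h2 ⊢
    rw [pow_succ]
    omega

theorem card_primes_fibZ_eq_le (T : Finset ℕ) (hT : ∀ p ∈ T, p.Prime) {n : ℕ} (hn : 0 < n) :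
    (T.filter (fun p => fibZ p = n)).card ≤ n := by
  have hsub : T.filter (fun p => fibZ p = n) ⊆ (Nat.fib n).primeFactors := by
    intro p hp
    rw [Finset.mem_filter] at hp
    have hmem : fibZ p ∈ {n : ℕ | 0 < n ∧ p ∣ Nat.fib n} := by
      apply Nat.sInf_mem
      apply Nat.nonempty_of_pos_sInf
      change 0 < fibZ p
      omega
    rw [hp.2] at hmem
    exact Nat.mem_primeFactors.mpr ⟨hT p hp.1, hmem.2, (Nat.fib_pos.mpr hn).ne'⟩
  refine (Finset.card_le_card hsub).trans ?_
  have h1 : 2 ^ (Nat.fib n).primeFactors.card ≤ ∏ p ∈ (Nat.fib n).primeFactors, p :=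
    Finset.pow_card_le_prod _ _ _ fun p hp => (Nat.prime_of_mem_primeFactors hp).two_le
  have h2 := Nat.le_of_dvd (Nat.fib_pos.mpr hn) (Nat.prod_primeFactors_dvd (Nat.fib n))
  exact (Nat.pow_le_pow_iff_right (by norm_num)).mp (h1.trans (h2.trans (fib_le_two_pow n)))

theorem summable_inv_fibZ_cube :
    Summable (fun p : {p : ℕ // p.Prime} => 1 / (fibZ p : ℝ) ^ 3) := by
  have hs : Summable (fun n : ℕ => 1 / (n : ℝ) ^ 2) :=
    Real.summable_one_div_nat_pow.mpr (by norm_num)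
  refine summable_of_sum_le (c := ∑' n : ℕ, 1 / (n : ℝ) ^ 2) (fun p => by positivity) fun T => ?_
  have hT : ∀ p ∈ T.map (Function.Embedding.subtype _), p.Prime := by
    intro p hp
    obtain ⟨q, -, rfl⟩ := Finset.mem_map.mp hp
    exact q.2
  have hmap : ∑ p ∈ T, 1 / (fibZ p : ℝ) ^ 3 =
      ∑ p ∈ T.map (Function.Embedding.subtype _), 1 / (fibZ p : ℝ) ^ 3 := by
    rw [Finset.sum_map]
    rfl
  rw [hmap, Finset.sum_comp (fun n : ℕ => 1 / (n : ℝ) ^ 3) fibZ]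
  refine (Finset.sum_le_sum fun n _ => ?_).trans
    (hs.sum_le_tsum _ fun n _ => by positivity)
  rcases Nat.eq_zero_or_pos n with rfl | hn
  · simp
  · have hc : ((Finset.filter (fun p => fibZ p = n)
        (T.map (Function.Embedding.subtype _))).card : ℝ) ≤ n :=
      by exact_mod_cast card_primes_fibZ_eq_le _ hT hn
    have hn' : (0 : ℝ) < n := by exact_mod_cast hn
    rw [nsmul_eq_mul]
    calc _ ≤ (n : ℝ) * (1 / (n : ℝ) ^ 3) := by gcongr
      _ = 1 / (n : ℝ) ^ 2 := by field_simp

theorem summable_inv_mul_fibZ :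
    Summable (fun p : {p : ℕ // p.Prime} => 1 / ((p : ℕ) * (fibZ p : ℝ))) := by
  have h1 : Summable (fun p : {p : ℕ // p.Prime} => 1 / ((p : ℕ) : ℝ) ^ (3 / 2 : ℝ)) :=
    (Real.summable_one_div_nat_rpow.mpr (by norm_num : (1 : ℝ) < 3 / 2)).subtype _
  refine Summable.of_nonneg_of_le (fun p => by positivity) (fun p => ?_)
    (h1.add summable_inv_fibZ_cube)
  have hp : (0 : ℝ) < (p : ℕ) := by exact_mod_cast p.2.pos
  rcases Nat.eq_zero_or_pos (fibZ p) with hz | hz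
  · simp only [hz]
    simp
    positivity
  have hz' : (0 : ℝ) < fibZ p := by exact_mod_cast hz
  rcases le_total ((fibZ p : ℝ) ^ 2) (p : ℕ) with h | h
  · have : 1 / ((p : ℕ) * (fibZ p : ℝ)) ≤ 1 / (fibZ p : ℝ) ^ 3 := by
      apply one_div_le_one_div_of_le (by positivity)
      nlinarith
    have h0 : 0 ≤ 1 / ((p : ℕ) : ℝ) ^ (3 / 2 : ℝ) := by positivity
    linarith
  · have : 1 / ((p : ℕ) * (fibZ p : ℝ)) ≤ 1 / ((p : ℕ) : ℝ) ^ (3 / 2 : ℝ) := by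
      apply one_div_le_one_div_of_le (by positivity)
      rw [show (3 / 2 : ℝ) = 1 + 1 / 2 by norm_num, Real.rpow_add hp, Real.rpow_one,
        ← Real.sqrt_eq_rpow]
      gcongr
      exact Real.sqrt_le_iff.mpr ⟨hz'.le, h⟩
    have h0 : 0 ≤ 1 / (fibZ p : ℝ) ^ 3 := by positivity
    linarith

/-! ### Densities -/

theorem finite_inter_initial (S : Set ℕ) (x : ℝ) :
    (S ∩ {n : ℕ | 1 ≤ n ∧ (n : ℝ) ≤ x}).Finite := by
  refine (Set.finite_Iic ⌊x⌋₊).subset ?_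
  rintro n ⟨-, -, h⟩
  exact Nat.le_floor h

theorem countIn_eq_count (S : Set ℕ) [DecidablePred (· ∈ S)] {x : ℝ} (hx : 0 ≤ x) :
    countIn S x = Nat.count (fun n => n + 1 ∈ S) ⌊x⌋₊ := by
  rw [Nat.count_eq_card_filter_range, countIn, ← Set.ncard_coe_finset,
    ← Set.ncard_image_of_injective
      (Finset.filter (fun n => n + 1 ∈ S) (Finset.range ⌊x⌋₊) : Set ℕ)
      Nat.succ_injective]
  congr 1
  ext n
  simp only [Set.mem_inter_iff, Set.mem_ofPred_eq, Finset.coe_filter, Finset.mem_range,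
    Set.mem_image, Nat.succ_eq_add_one]
  constructor
  · rintro ⟨hS, h1, h2⟩
    have := Nat.le_floor h2
    refine ⟨n - 1, ⟨by omega, ?_⟩, by omega⟩
    rwa [Nat.sub_add_cancel h1]
  · rintro ⟨m, ⟨hm, hS⟩, rfl⟩
    exact ⟨hS, by omega, (Nat.le_floor_iff hx).mp hm⟩

theorem count_mul_add_of_periodic (P : ℕ → Prop) [DecidablePred P] {m : ℕ}
    (hP : ∀ n, P (n + m) ↔ P n) (q r : ℕ) :
    Nat.count P (m * q + r) = q * Nat.count P m + Nat.count P r := by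
  induction q with
  | zero => simp
  | succ q ih =>
    rw [show m * (q + 1) + r = m + (m * q + r) by ring, Nat.count_add]
    have : Nat.count (fun k => P (m + k)) (m * q + r) = Nat.count P (m * q + r) := by
      simp only [add_comm m, hP]
    rw [this, ih]
    ring

theorem hasDensity_of_periodic (S : Set ℕ) {m : ℕ} (hm : 0 < m)
    (hS : ∀ n, 0 < n → (n + m ∈ S ↔ n ∈ S)) : ∃ a : ℝ, HasDensity S a := by
  classical
  set P : ℕ → Prop := fun n => n + 1 ∈ S
  have hP : ∀ n, P (n + m) ↔ P n := fun n => by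
    have := hS (n + 1) n.succ_pos
    rwa [add_right_comm] at this
  set c := Nat.count P m
  have hcm : (c : ℝ) ≤ m := by exact_mod_cast Nat.count_le _
  have hm' : (0 : ℝ) < m := by exact_mod_cast hm
  have key : ∀ x : ℝ, 0 ≤ x → |(countIn S x : ℝ) - c / m * x| ≤ m + 1 := by
    intro x hx
    rw [countIn_eq_count S hx]
    have hN := Nat.div_add_mod ⌊x⌋₊ m
    set q := ⌊x⌋₊ / m
    set r := ⌊x⌋₊ % m
    have hrm : (r : ℝ) ≤ m := by exact_mod_cast (Nat.mod_lt _ hm).le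
    have hcount : Nat.count P ⌊x⌋₊ = q * c + Nat.count P r := by
      rw [← hN, count_mul_add_of_periodic P hP]
    have hcr : (Nat.count P r : ℝ) ≤ r := by exact_mod_cast Nat.count_le _
    have hcr0 : (0 : ℝ) ≤ Nat.count P r := Nat.cast_nonneg _
    have hN' : (m : ℝ) * q + r = ⌊x⌋₊ := by exact_mod_cast hN
    have hf1 := Nat.floor_le hx
    have hf2 := Nat.lt_floor_add_one x
    have hd0 : 0 ≤ (c : ℝ) / m := by positivity
    have hd1 : (c : ℝ) / m ≤ 1 := (div_le_one hm').mpr hcm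
    have hqc : (q : ℝ) * c = c / m * (m * q) := by field_simp
    rw [hcount]
    push_cast
    have hsplit : (q : ℝ) * c + Nat.count P r - c / m * x
        = Nat.count P r - c / m * (x - m * q) := by rw [hqc]; ring
    rw [hsplit, abs_le]
    have hlo : 0 ≤ x - m * q := by
      have : (0 : ℝ) ≤ r := Nat.cast_nonneg _
      linarith
    constructor
    · have : (c : ℝ) / m * (x - m * q) ≤ x - m * q := mul_le_of_le_one_left hlo hd1
      linarith
    · have := mul_nonneg hd0 hlo
      linarith
  refine ⟨c / m, ?_⟩
  unfold HasDensity
  rw [tendsto_iff_norm_sub_tendsto_zero]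
  have hlim : Filter.Tendsto (fun x : ℝ => ((m : ℝ) + 1) / x) Filter.atTop (nhds 0) :=
    tendsto_const_nhds.div_atTop Filter.tendsto_id
  refine squeeze_zero' (Filter.Eventually.of_forall fun x => norm_nonneg _) ?_ hlim
  filter_upwards [Filter.eventually_gt_atTop 0] with x hx
  have : (countIn S x : ℝ) / x - c / m = (countIn S x - c / m * x) / x := by
    field_simp
  rw [this, Real.norm_eq_abs, abs_div, abs_of_pos hx]
  gcongr
  exact key x hx.le

/-- A set that is approximated arbitrarily well, uniformly in upper count, by sets possessing a
density itself possesses a density. -/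
theorem hasDensity_of_approx (S : Set ℕ)
    (h : ∀ ε : ℝ, 0 < ε → ∃ (B : Set ℕ) (a : ℝ), HasDensity B a ∧
      ∀ x : ℝ, 0 < x → |(countIn S x : ℝ) - countIn B x| ≤ ε * x) :
    ∃ a : ℝ, HasDensity S a := by
  unfold HasDensity
  rw [← cauchy_map_iff_exists_tendsto, Metric.cauchy_iff]
  refine ⟨inferInstance, fun ε hε => ?_⟩
  obtain ⟨B, a, hB, hSB⟩ := h (ε / 6) (by positivity)
  have hev : ∀ᶠ x : ℝ in Filter.atTop, dist ((countIn S x : ℝ) / x) a < ε / 2 := by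
    filter_upwards [Metric.tendsto_nhds.mp hB (ε / 6) (by positivity),
      Filter.eventually_gt_atTop 0] with x hx hx0
    have h1 : dist ((countIn S x : ℝ) / x) (countIn B x / x) ≤ ε / 6 := by
      rw [Real.dist_eq, ← sub_div, abs_div, abs_of_pos hx0, div_le_iff₀ hx0]
      exact hSB x hx0
    have h2 := dist_triangle ((countIn S x : ℝ) / x) (countIn B x / x) a
    linarith
  refine ⟨Metric.ball a (ε / 2), hev, fun u hu v hv => ?_⟩
  have h3 := dist_triangle_right u v a
  rw [Metric.mem_ball] at hu hv
  linarith

theorem countIn_le_of_subset_union {A B D : Set ℕ} (hBA : B ⊆ A ∪ D) (x : ℝ) :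
    countIn B x ≤ countIn A x + countIn D x := by
  unfold countIn
  refine le_trans (Set.ncard_le_ncard ?_
    ((finite_inter_initial A x).union (finite_inter_initial D x))) (Set.ncard_union_le _ _)
  rw [← Set.union_inter_distrib_right]
  exact Set.inter_subset_inter_left _ hBA

theorem countIn_mono {A B : Set ℕ} (h : A ⊆ B) (x : ℝ) : countIn A x ≤ countIn B x :=
  Set.ncard_le_ncard (Set.inter_subset_inter_left _ h) (finite_inter_initial B x)

theorem countIn_dvd_le (d : ℕ) {x : ℝ} (hx : 0 ≤ x) :
    (countIn {n | d ∣ n} x : ℝ) ≤ x * (1 / d) := by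
  have h : countIn {n | d ∣ n} x = ⌊x⌋₊ / d := by
    rw [← Nat.Ioc_filter_dvd_card_eq_div, countIn, ← Set.ncard_coe_finset]
    congr 1
    ext n
    simp only [Set.mem_inter_iff, Set.mem_ofPred_eq, Finset.coe_filter, Finset.mem_Ioc,
      Nat.le_floor_iff hx, Nat.lt_iff_add_one_le, zero_add]
    tauto
  rw [h, mul_one_div]
  refine Nat.cast_div_le.trans ?_
  gcongr
  exact Nat.floor_le hx

/-! ### Periodicity of the finite sieve -/

theorem exists_period_dvd_gcd_fib {d : ℕ} (hd : 0 < d) :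
    ∃ m, 0 < m ∧ ∀ n, 0 < n →
      (d ∣ Nat.gcd (n + m) (Nat.fib (n + m)) ↔ d ∣ Nat.gcd n (Nat.fib n)) := by
  by_cases h : ∃ n, 0 < n ∧ d ∣ Nat.fib n
  · obtain ⟨n₀, hn₀, hdn₀⟩ := h
    obtain ⟨hz, hdz⟩ := fibZ_spec hn₀ hdn₀
    have hiff : ∀ n, 0 < n → (d ∣ Nat.fib n ↔ fibZ d ∣ n) := fun n hn =>
      ⟨fibZ_dvd hn, fun hzn => hdz.trans (Nat.fib_dvd _ _ hzn)⟩
    refine ⟨d * fibZ d, Nat.mul_pos hd hz, fun n hn => ?_⟩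
    rw [Nat.dvd_gcd_iff, Nat.dvd_gcd_iff, hiff n hn, hiff _ (by omega),
      Nat.dvd_add_left (dvd_mul_right _ _), Nat.dvd_add_left (dvd_mul_left _ _)]
  · push Not at h
    refine ⟨1, one_pos, fun n hn => ?_⟩
    rw [Nat.dvd_gcd_iff, Nat.dvd_gcd_iff]
    have h1 := h n hn
    have h2 := h (n + 1) n.succ_pos
    tauto

theorem iff_add_mul_of_periodic {Q : ℕ → Prop} {m : ℕ}
    (h : ∀ n, 0 < n → (Q (n + m) ↔ Q n)) (t : ℕ) {n : ℕ} (hn : 0 < n) :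
    Q (n + m * t) ↔ Q n := by
  induction t with
  | zero => simp
  | succ t ih => rw [Nat.mul_succ, ← add_assoc, h _ (by omega), ih]

theorem exists_period_sieve {k : ℕ} (hk : 0 < k) (s : Finset {p : ℕ // p.Prime}) :
    ∃ m, 0 < m ∧ ∀ n, 0 < n →
      ((k ∣ Nat.gcd (n + m) (Nat.fib (n + m)) ∧
          ∀ p ∈ s, ¬ k * (p : ℕ) ∣ Nat.gcd (n + m) (Nat.fib (n + m))) ↔
        (k ∣ Nat.gcd n (Nat.fib n) ∧ ∀ p ∈ s, ¬ k * (p : ℕ) ∣ Nat.gcd n (Nat.fib n))) := by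
  classical
  induction s using Finset.induction_on with
  | empty => simpa using exists_period_dvd_gcd_fib hk
  | insert p s _ ih =>
    obtain ⟨m, hm, h⟩ := ih
    obtain ⟨m', hm', h'⟩ := exists_period_dvd_gcd_fib (Nat.mul_pos hk p.2.pos)
    refine ⟨m * m', Nat.mul_pos hm hm', fun n hn => ?_⟩
    have e := iff_add_mul_of_periodic (Q := fun n => k ∣ Nat.gcd n (Nat.fib n) ∧
      ∀ p ∈ s, ¬ k * (p : ℕ) ∣ Nat.gcd n (Nat.fib n)) h m' hn
    have e' := iff_add_mul_of_periodic
      (Q := fun n => k * (p : ℕ) ∣ Nat.gcd n (Nat.fib n)) h' m hn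
    rw [mul_comm m' m] at e'
    simp only [Finset.forall_mem_insert]
    tauto

theorem eq_of_dvd_of_forall_prime_not_dvd {k g : ℕ} (hkg : k ∣ g)
    (h : ∀ p : ℕ, p.Prime → ¬ k * p ∣ g) : g = k := by
  obtain ⟨t, rfl⟩ := hkg
  by_contra hne
  have ht : t ≠ 1 := by
    rintro rfl
    simp at hne
  obtain ⟨p, hp, hpt⟩ := Nat.exists_prime_and_dvd ht
  exact h p hp (Nat.mul_dvd_mul_left k hpt)

/-- The positive `n` for which some prime outside `s` divides `gcd(n, F_n)` are rare when `s`
captures almost all of `∑ 1 / (p z(p))`. -/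
theorem countIn_exists_prime_le {ε : ℝ} {s : Finset {p : ℕ // p.Prime}}
    (h5 : ⟨5, Nat.prime_five⟩ ∈ s)
    (hs : ∀ t : Finset {p : ℕ // p.Prime}, Disjoint t s →
      ∑ p ∈ t, 1 / ((p : ℕ) * (fibZ p : ℝ)) ≤ ε) {x : ℝ} (hx : 0 ≤ x) :
    (countIn {n | 0 < n ∧ ∃ p : {p : ℕ // p.Prime}, p ∉ s ∧
      (p : ℕ) ∣ Nat.gcd n (Nat.fib n)} x : ℝ) ≤ ε * x := by
  classical
  set t : Finset {p : ℕ // p.Prime} := (Finset.range (⌊x⌋₊ + 1)).subtype Nat.Prime \ s with ht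
  have hcard : countIn {n | 0 < n ∧ ∃ p : {p : ℕ // p.Prime}, p ∉ s ∧
      (p : ℕ) ∣ Nat.gcd n (Nat.fib n)} x ≤
      ∑ p ∈ t, countIn {n | (p : ℕ) * fibZ p ∣ n} x := by
    unfold countIn
    refine le_trans (Set.ncard_le_ncard ?_ ?_) (Finset.set_ncard_biUnion_le t _)
    · rintro n ⟨⟨hn, p, hps, hpn⟩, h1, hnx⟩
      rw [Nat.dvd_gcd_iff] at hpn
      have hp5 : (p : ℕ) ≠ 5 := by
        intro h
        apply hps
        rwa [show p = ⟨5, Nat.prime_five⟩ from Subtype.ext h]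
      simp only [Set.mem_iUnion]
      refine ⟨p, ?_, mul_fibZ_dvd p.2 hp5 hn hpn.1 hpn.2, h1, hnx⟩
      have := Nat.le_of_dvd hn hpn.1
      have := Nat.le_floor hnx
      simp only [ht, Finset.mem_sdiff, Finset.mem_subtype, Finset.mem_range]
      exact ⟨by omega, hps⟩
    · exact t.finite_toSet.biUnion fun p _ => finite_inter_initial _ x
  calc _ ≤ ∑ p ∈ t, (countIn {n | (p : ℕ) * fibZ p ∣ n} x : ℝ) := by exact_mod_cast hcard
    _ ≤ ∑ p ∈ t, x * (1 / ((p : ℕ) * (fibZ p : ℝ))) := by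
        refine Finset.sum_le_sum fun p _ => ?_
        have := countIn_dvd_le ((p : ℕ) * fibZ p) hx
        rwa [Nat.cast_mul] at this
    _ = (∑ p ∈ t, 1 / ((p : ℕ) * (fibZ p : ℝ))) * x := by rw [← Finset.mul_sum, mul_comm]
    _ ≤ ε * x := by
        gcongr
        exact hs t Finset.sdiff_disjoint

theorem density_of_fibA_exists (k : ℕ) (hk : 0 < k) :
    ∃ a : ℝ, HasDensity (fibA k) a := by
  classical
  refine hasDensity_of_approx _ fun ε hε => ?_
  obtain ⟨s₀, hs₀⟩ := summable_iff_vanishing_norm.mp summable_inv_mul_fibZ ε hε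
  set s := insert (⟨5, Nat.prime_five⟩ : {p : ℕ // p.Prime}) s₀
  obtain ⟨m, hm, hper⟩ := exists_period_sieve hk s
  set B : Set ℕ := {n | k ∣ Nat.gcd n (Nat.fib n) ∧
    ∀ p ∈ s, ¬ k * (p : ℕ) ∣ Nat.gcd n (Nat.fib n)}
  set D : Set ℕ := {n | 0 < n ∧ ∃ p : {p : ℕ // p.Prime}, p ∉ s ∧
    (p : ℕ) ∣ Nat.gcd n (Nat.fib n)}
  obtain ⟨a, ha⟩ := hasDensity_of_periodic B hm hper
  refine ⟨B, a, ha, fun x hx => ?_⟩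
  have hAB : fibA k ⊆ B := by
    rintro n ⟨hn, hg⟩
    refine ⟨hg.symm.dvd, fun p _ hp => ?_⟩
    rw [hg] at hp
    have := Nat.le_of_dvd hk hp
    have := p.2.two_le
    nlinarith
  have hBAD : B ∩ {n | 0 < n} ⊆ fibA k ∪ D := by
    rintro n ⟨⟨hkn, hsn⟩, hn⟩
    by_cases h : ∃ p : {p : ℕ // p.Prime}, k * (p : ℕ) ∣ Nat.gcd n (Nat.fib n)
    · obtain ⟨p, hp⟩ := h
      exact Or.inr ⟨hn, p, fun hps => hsn p hps hp, (dvd_mul_left _ _).trans hp⟩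
    · push Not at h
      exact Or.inl ⟨hn, eq_of_dvd_of_forall_prime_not_dvd hkn fun p hp => h ⟨p, hp⟩⟩
  have hBpos : countIn B x = countIn (B ∩ {n | 0 < n}) x := by
    unfold countIn
    congr 1
    ext n
    simp only [Set.mem_inter_iff, Set.mem_ofPred_eq, Nat.lt_iff_add_one_le, zero_add]
    tauto
  have h1 : (countIn (fibA k) x : ℝ) ≤ countIn B x := by exact_mod_cast countIn_mono hAB x
  have h2 : (countIn B x : ℝ) ≤ countIn (fibA k) x + countIn D x := by
    rw [hBpos]
    exact_mod_cast countIn_le_of_subset_union hBAD x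
  have h3 : (countIn D x : ℝ) ≤ ε * x := by
    refine countIn_exists_prime_le (Finset.mem_insert_self _ _) (fun t ht => ?_) hx.le
    have := hs₀ t (ht.mono_right (Finset.subset_insert _ _))
    exact (le_abs_self _).trans this.le
  rw [abs_le]
  constructor <;> linarith
end

section
/- For each positive integer k, the asymptotic density of A_k = {n ≥ 1 : gcd(n, F_n) = k} exists and equals the sum over all positive integers d of μ(d) / ℓ(dk), where μ is the Möbius function; moreover this series converges. -/
open scoped BigOperators

theorem exists_pos_dvd_fib {m : ℕ} (hm : 0 < m) : ∃ n, 0 < n ∧ m ∣ Nat.fib n := by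
  have : NeZero m := ⟨hm.ne'⟩
  let e : Equiv.Perm (ZMod m × ZMod m) :=
    { toFun := fun x => (x.2, x.1 + x.2)
      invFun := fun x => (x.2 - x.1, x.1)
      left_inv := fun x => by simp
      right_inv := fun x => by simp }
  have key (n : ℕ) : (e ^ n) (0, 1) = ((Nat.fib n : ZMod m), (Nat.fib (n + 1) : ZMod m)) := by
    induction n with
    | zero => simp
    | succ n ih =>
      rw [pow_succ', Equiv.Perm.mul_apply, ih, Nat.fib_add_two]
      simp [e]
  refine ⟨orderOf e, orderOf_pos e, ?_⟩
  have h := key (orderOf e)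
  rw [pow_orderOf_eq_one, Equiv.Perm.one_apply, Prod.mk.injEq] at h
  exact (ZMod.natCast_eq_zero_iff _ _).1 h.1.symm

theorem fibZ_spec_s2 {m : ℕ} (hm : 0 < m) : 0 < fibZ m ∧ m ∣ Nat.fib (fibZ m) :=
  Nat.sInf_mem (exists_pos_dvd_fib hm)

theorem fibZ_dvd_iff {m : ℕ} (hm : 0 < m) (n : ℕ) : fibZ m ∣ n ↔ m ∣ Nat.fib n := by
  obtain ⟨h0, h1⟩ := fibZ_spec_s2 hm
  refine ⟨fun h => h1.trans (Nat.fib_dvd _ _ h), fun h => ?_⟩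
  have hg : m ∣ Nat.fib (Nat.gcd (fibZ m) n) := by
    rw [Nat.fib_gcd]
    exact Nat.dvd_gcd h1 h
  have hle : fibZ m ≤ Nat.gcd (fibZ m) n := Nat.sInf_le ⟨Nat.gcd_pos_of_pos_left _ h0, hg⟩
  exact Nat.gcd_eq_left_iff_dvd.1 (le_antisymm (Nat.gcd_le_left _ h0) hle)

theorem fibL_dvd_iff {m : ℕ} (hm : 0 < m) (n : ℕ) : fibL m ∣ n ↔ m ∣ Nat.gcd n (Nat.fib n) := by
  rw [fibL, Nat.lcm_dvd_iff, fibZ_dvd_iff hm, Nat.dvd_gcd_iff]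

theorem fibL_pos {m : ℕ} (hm : 0 < m) : 0 < fibL m :=
  Nat.lcm_pos hm (fibZ_spec_s2 hm).1

theorem fibL_dvd_fibL {m n : ℕ} (hn : 0 < n) (h : m ∣ n) : fibL m ∣ fibL n := by
  rw [fibL_dvd_iff (Nat.pos_of_dvd_of_pos h hn)]
  exact h.trans ((fibL_dvd_iff hn _).1 dvd_rfl)

theorem fib_succ_mul_fib_pred (n : ℕ) :
    (Nat.fib (n + 2) * Nat.fib n : ℤ) - (Nat.fib (n + 1) : ℤ) ^ 2 = (-1) ^ (n + 1) := by
  induction n with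
  | zero => simp
  | succ n ih =>
    have h1 : (Nat.fib (n + 1 + 2) : ℤ) = Nat.fib (n + 1) + Nat.fib (n + 2) := by
      rw [Nat.fib_add_two]; push_cast; rfl
    have h2 : (Nat.fib (n + 2) : ℤ) = Nat.fib n + Nat.fib (n + 1) := by
      rw [Nat.fib_add_two]; push_cast; rfl
    rw [h1]
    linear_combination -ih - (Nat.fib (n + 2) : ℤ) * h2

theorem sq_fib_prime {p : ℕ} [Fact p.Prime] (h5 : p ≠ 5) : (Nat.fib p : ZMod p) ^ 2 = 1 := by
  have hp : p.Prime := Fact.out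
  let K := AlgebraicClosure (ZMod p)
  have : CharP K p := charP_of_injective_algebraMap (algebraMap (ZMod p) K).injective p
  obtain ⟨a, ha⟩ : ∃ a : K, a ^ 2 = a + 1 := by
    have hd : (Polynomial.X ^ 2 - Polynomial.X - 1 : Polynomial K).degree ≠ 0 := by
      have : (Polynomial.X ^ 2 - Polynomial.X - 1 : Polynomial K).degree = 2 := by
        compute_degree!
      rw [this]; decide
    obtain ⟨a, ha⟩ := IsAlgClosed.exists_root _ hd
    refine ⟨a, ?_⟩
    simp only [Polynomial.IsRoot, Polynomial.eval_sub, Polynomial.eval_pow, Polynomial.eval_X,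
      Polynomial.eval_one] at ha
    linear_combination ha
  have binet (n : ℕ) : (a - (1 - a)) * (Nat.fib n : K) = a ^ n - (1 - a) ^ n := by
    induction n using Nat.twoStepInduction with
    | zero => simp
    | one => simp
    | more n h1 h2 =>
      rw [Nat.fib_add_two]
      push_cast
      linear_combination h1 + h2 + (-a ^ n + (1 - a) ^ n) * ha
  have hδ : (a - (1 - a)) ^ 2 = 5 := by linear_combination 4 * ha
  have hfrob : (a - (1 - a)) * (Nat.fib p : K) = (a - (1 - a)) ^ p := by
    rw [binet, ← sub_pow_char]
  have h5p : (5 : K) ^ p = 5 := by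
    rw [← map_ofNat (algebraMap (ZMod p) K) 5, ← map_pow, ZMod.pow_card]
  have h50 : (5 : K) ≠ 0 := by
    intro h
    have h' : ((5 : ℕ) : K) = 0 := by exact_mod_cast h
    rw [CharP.cast_eq_zero_iff K p] at h'
    exact h5 ((Nat.prime_dvd_prime_iff_eq hp Nat.prime_five).1 h')
  have hK : (Nat.fib p : K) ^ 2 = 1 := by
    apply mul_left_cancel₀ h50
    calc 5 * (Nat.fib p : K) ^ 2 = ((a - (1 - a)) * (Nat.fib p : K)) ^ 2 := by rw [mul_pow, hδ]
      _ = 5 * 1 := by rw [hfrob, ← pow_mul, mul_comm, pow_mul, hδ, h5p, mul_one]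
  apply (algebraMap (ZMod p) K).injective
  simpa using hK

theorem coprime_fibZ_prime {p : ℕ} (hp : p.Prime) (h5 : p ≠ 5) : Nat.Coprime p (fibZ p) := by
  have : Fact p.Prime := ⟨hp⟩
  obtain ⟨n, rfl⟩ : ∃ n, p = n + 1 := ⟨p - 1, by have := hp.pos; omega⟩
  have hodd : (-1 : ZMod (n + 1)) ^ (n + 1) = -1 := by
    exact ZMod.pow_card (-1 : ZMod (n + 1))
  have h : n + 1 ∣ Nat.fib (n + 2) * Nat.fib n := by
    rw [← ZMod.natCast_eq_zero_iff]
    have hc := congrArg (Int.cast : ℤ → ZMod (n + 1)) (fib_succ_mul_fib_pred n)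
    push_cast at hc ⊢
    rw [sq_fib_prime h5, hodd] at hc
    linear_combination hc
  rw [hp.coprime_iff_not_dvd]
  intro hz
  rcases (hp.dvd_mul).1 h with h | h
  · have h1 := hz.trans ((fibZ_dvd_iff hp.pos _).2 h)
    have h2 : n + 1 ∣ 1 := (Nat.dvd_add_right (dvd_refl (n + 1))).1 h1
    exact hp.one_lt.ne' (Nat.dvd_one.1 h2)
  · have h1 := hz.trans ((fibZ_dvd_iff hp.pos _).2 h)
    have hn : 0 < n := by have := hp.one_lt; omega
    exact absurd (Nat.le_of_dvd hn h1) (by omega)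

theorem gcd_prime_fibZ_le {p : ℕ} (hp : p.Prime) : Nat.gcd p (fibZ p) ≤ 5 := by
  by_cases h5 : p = 5
  · subst h5
    exact Nat.gcd_le_left _ (by norm_num)
  · rw [coprime_fibZ_prime hp h5]
    norm_num

theorem two_pow_card_primeFactors_le {n : ℕ} (hn : n ≠ 0) : 2 ^ n.primeFactors.card ≤ n := by
  calc 2 ^ n.primeFactors.card ≤ ∏ p ∈ n.primeFactors, p :=
        Finset.pow_card_le_prod _ _ _ fun p hp => (Nat.prime_of_mem_primeFactors hp).two_le
    _ ≤ n := Nat.le_of_dvd (Nat.pos_of_ne_zero hn) (Nat.prod_primeFactors_dvd n)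

theorem card_le_of_fibZ_eq {S : Finset ℕ} {n : ℕ} (hn : n ≠ 0)
    (hS : ∀ p ∈ S, p.Prime ∧ fibZ p = n) : S.card ≤ n := by
  have hf : Nat.fib n ≠ 0 := by simpa using hn
  have hsub : S ⊆ (Nat.fib n).primeFactors := fun p hp => by
    obtain ⟨h1, h2⟩ := hS p hp
    exact Nat.mem_primeFactors.2 ⟨h1, h2 ▸ (fibZ_spec_s2 h1.pos).2, hf⟩
  refine (Finset.card_le_card hsub).trans ((Nat.pow_le_pow_iff_right one_lt_two).1 ?_)
  exact (two_pow_card_primeFactors_le hf).trans (fib_le_two_pow n)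

/-- The number of squarefree divisors of `n` is at most `4 √n`. -/
theorem two_pow_card_primeFactors_le_sqrt {n : ℕ} (hn : n ≠ 0) :
    (2 : ℝ) ^ n.primeFactors.card ≤ 4 * √n := by
  set S := n.primeFactors
  have h1 : (2 : ℝ) ^ S.card = (∏ p ∈ S, 2 / √p) * ∏ p ∈ S, √(p : ℝ) := by
    rw [← Finset.prod_mul_distrib, ← Finset.prod_const]
    refine Finset.prod_congr rfl fun p hp => ?_
    have : 0 < √(p : ℝ) := Real.sqrt_pos.2 (by exact_mod_cast (Nat.prime_of_mem_primeFactors hp).pos)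
    field_simp
  have h2 : ∏ p ∈ S, √(p : ℝ) ≤ √n := by
    rw [← Real.sqrt_prod _ fun _ _ => Nat.cast_nonneg _]
    apply Real.sqrt_le_sqrt
    rw [← Nat.cast_prod]
    exact Nat.cast_le.2 (Nat.le_of_dvd (Nat.pos_of_ne_zero hn) (Nat.prod_primeFactors_dvd n))
  have h3 : ∏ p ∈ S, 2 / √(p : ℝ) ≤ 4 := by
    rw [← Finset.prod_filter_mul_prod_filter_not S (· < 4)]
    have ha : ∏ p ∈ S with p < 4, 2 / √(p : ℝ) ≤ 4 := by
      calc ∏ p ∈ S with p < 4, 2 / √(p : ℝ) ≤ ∏ p ∈ S with p < 4, (2 : ℝ) := by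
            refine Finset.prod_le_prod (fun _ _ => by positivity) fun p hp => ?_
            have : 1 ≤ √(p : ℝ) := Real.one_le_sqrt.2 (by
              exact_mod_cast (Nat.prime_of_mem_primeFactors (Finset.mem_filter.1 hp).1).one_le)
            exact div_le_self (by norm_num) this
        _ = 2 ^ (S.filter (· < 4)).card := by rw [Finset.prod_const]
        _ ≤ 2 ^ 2 := by
            refine pow_le_pow_right₀ (by norm_num) ?_
            refine (Finset.card_le_card (t := {2, 3}) fun p hp => ?_).trans (by simp)
            obtain ⟨h, h4⟩ := Finset.mem_filter.1 hp
            have := (Nat.prime_of_mem_primeFactors h).two_le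
            simp; omega
        _ = 4 := by norm_num
    have hb : ∏ p ∈ S with ¬ p < 4, 2 / √(p : ℝ) ≤ 1 := by
      refine Finset.prod_le_one (fun _ _ => by positivity) fun p hp => ?_
      have h4 : (4 : ℝ) ≤ p := by exact_mod_cast not_lt.1 (Finset.mem_filter.1 hp).2
      have : 2 ≤ √(p : ℝ) := Real.le_sqrt_of_sq_le (by linarith)
      rw [div_le_one (by linarith)]
      exact this
    calc _ ≤ (4 : ℝ) * 1 := mul_le_mul ha hb (Finset.prod_nonneg fun _ _ => by positivity) (by norm_num)
      _ = 4 := by norm_num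
  rw [h1]
  exact mul_le_mul h3 h2 (Finset.prod_nonneg fun _ _ => by positivity) (by norm_num)

theorem eventually_card_primesBelow_le {c : ℝ} (hc : 0 < c) :
    ∀ᶠ n : ℕ in Filter.atTop, ((Nat.primesBelow n).card : ℝ) ≤ c * n := by
  have h1 := tendsto_natCast_atTop_atTop.eventually
    (Chebyshev.eventually_primeCounting_le (ε := 1) one_pos)
  have h2 := (Real.tendsto_log_atTop.comp tendsto_natCast_atTop_atTop).eventually_ge_atTop
    ((Real.log 4 + 1) / c)
  filter_upwards [h1, h2, Filter.eventually_ge_atTop 2] with n hn hl h2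
  have hlog : 0 < Real.log n := Real.log_pos (by exact_mod_cast h2)
  rw [Nat.floor_natCast] at hn
  have hle : ((Nat.primesBelow n).card : ℝ) ≤ Nat.primeCounting n := by
    rw [Nat.primesBelow_card_eq_primeCounting']
    exact_mod_cast Nat.monotone_primeCounting' (Nat.le_succ n)
  refine (hle.trans hn).trans ?_
  rw [div_le_iff₀ hlog]
  have h3 : Real.log 4 + 1 ≤ Real.log n * c := (div_le_iff₀ hc).1 hl
  nlinarith [mul_le_mul_of_nonneg_right h3 (Nat.cast_nonneg (α := ℝ) n)]

theorem prod_primesBelow_mono {m n : ℕ} (h : m ≤ n) :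
    ∏ q ∈ Nat.primesBelow m, (1 + 1 / (q : ℝ)) ≤ ∏ q ∈ Nat.primesBelow n, (1 + 1 / (q : ℝ)) :=
  Finset.prod_le_prod_of_subset_of_one_le
    (fun q hq => Nat.mem_primesBelow.2
      ⟨(Nat.mem_primesBelow.1 hq).1.trans_le h, (Nat.mem_primesBelow.1 hq).2⟩)
    (fun _ _ => by positivity) (fun q _ _ => by simp)

theorem prod_primesBelow_le_half {n : ℕ} (h2 : 2 ≤ n)
    (hn : ((Nat.primesBelow n).card : ℝ) ≤ Real.log 2 / 24 * n) :
    ∏ q ∈ Nat.primesBelow n, (1 + 1 / (q : ℝ)) ≤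
      (∏ q ∈ Nat.primesBelow (n / 2), (1 + 1 / (q : ℝ))) * 2 ^ (1 / 8 : ℝ) := by
  set m := n / 2
  have hm : 0 < m := by omega
  have hsub : Nat.primesBelow m ⊆ Nat.primesBelow n := fun q hq => Nat.mem_primesBelow.2
    ⟨(Nat.mem_primesBelow.1 hq).1.trans_le (Nat.div_le_self n 2), (Nat.mem_primesBelow.1 hq).2⟩
  rw [← Finset.prod_sdiff hsub, mul_comm]
  refine mul_le_mul_of_nonneg_left ?_ (Finset.prod_nonneg fun _ _ => by positivity)
  have hm' : (0 : ℝ) < m := by exact_mod_cast hm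
  have hnm : (n : ℝ) ≤ 3 * m := by exact_mod_cast (by omega : n ≤ 3 * m)
  calc ∏ q ∈ Nat.primesBelow n \ Nat.primesBelow m, (1 + 1 / (q : ℝ))
      ≤ ∏ q ∈ Nat.primesBelow n \ Nat.primesBelow m, Real.exp (1 / m) := by
        refine Finset.prod_le_prod (fun _ _ => by positivity) fun q hq => ?_
        obtain ⟨h1, h2⟩ := Finset.mem_sdiff.1 hq
        have hq' : m ≤ q := by
          by_contra! h
          exact h2 (Nat.mem_primesBelow.2 ⟨h, (Nat.mem_primesBelow.1 h1).2⟩)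
        have : 1 / (q : ℝ) ≤ 1 / m := one_div_le_one_div_of_le hm' (by exact_mod_cast hq')
        linarith [Real.add_one_le_exp (1 / (m : ℝ))]
    _ = Real.exp ((Nat.primesBelow n \ Nat.primesBelow m).card * (1 / m)) := by
        rw [Finset.prod_const, Real.exp_nat_mul]
    _ ≤ Real.exp (Real.log 2 * (1 / 8)) := by
        apply Real.exp_le_exp.2
        have h1 : ((Nat.primesBelow n \ Nat.primesBelow m).card : ℝ) ≤ Real.log 2 / 24 * n :=
          le_trans (by exact_mod_cast Finset.card_le_card Finset.sdiff_subset) hn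
        rw [mul_one_div, div_le_iff₀ hm']
        have := Real.log_pos one_lt_two
        nlinarith
    _ = 2 ^ (1 / 8 : ℝ) := by rw [Real.rpow_def_of_pos two_pos]

theorem exists_prod_primesBelow_le :
    ∃ C : ℝ, 0 < C ∧ ∀ n : ℕ, 0 < n →
      ∏ q ∈ Nat.primesBelow n, (1 + 1 / (q : ℝ)) ≤ C * (n : ℝ) ^ (1 / 8 : ℝ) := by
  obtain ⟨M, hM⟩ := Filter.eventually_atTop.1
    (eventually_card_primesBelow_le (c := Real.log 2 / 24) (by
      have := Real.log_pos one_lt_two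
      positivity))
  refine ⟨∏ q ∈ Nat.primesBelow (M + 2), (1 + 1 / (q : ℝ)),
    Finset.prod_pos fun _ _ => by positivity, fun n => ?_⟩
  set C := ∏ q ∈ Nat.primesBelow (M + 2), (1 + 1 / (q : ℝ))
  have hC : 0 ≤ C := Finset.prod_nonneg fun _ _ => by positivity
  induction n using Nat.strong_induction_on with
  | _ n ih =>
    intro hn
    rcases lt_or_ge n (M + 2) with h | h
    · refine (prod_primesBelow_mono h.le).trans (le_mul_of_one_le_right hC ?_)
      exact Real.one_le_rpow (by exact_mod_cast hn) (by norm_num)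
    · refine (prod_primesBelow_le_half (by omega) (hM n (by omega))).trans ?_
      have h1 := ih (n / 2) (by omega) (by omega)
      calc _ ≤ C * ((n / 2 : ℕ) : ℝ) ^ (1 / 8 : ℝ) * 2 ^ (1 / 8 : ℝ) :=
            mul_le_mul_of_nonneg_right h1 (by positivity)
        _ = C * (((n / 2 : ℕ) : ℝ) * 2) ^ (1 / 8 : ℝ) := by
            rw [Real.mul_rpow (by positivity) (by norm_num), mul_assoc]
        _ ≤ C * (n : ℝ) ^ (1 / 8 : ℝ) := by
            refine mul_le_mul_of_nonneg_left (Real.rpow_le_rpow (by positivity) ?_ (by norm_num)) hC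
            exact_mod_cast Nat.div_mul_le_self n 2

theorem gcd_prod_dvd_prod_gcd (s : Finset ℕ) (z : ℕ) :
    Nat.gcd (∏ q ∈ s, q) z ∣ ∏ q ∈ s, Nat.gcd q z := by
  induction s using Finset.induction_on with
  | empty => simp
  | insert a s ha ih =>
    rw [Finset.prod_insert ha, Finset.prod_insert ha]
    exact (Nat.gcd_mul_left_dvd_mul_gcd _ _ _).trans (mul_dvd_mul_left _ ih)

theorem one_div_fibL_mul_prod_le {p : ℕ} (hp : p.Prime) {s : Finset ℕ}
    (hs : ∀ q ∈ s, q.Prime) :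
    1 / (fibL (p * ∏ q ∈ s, q) : ℝ) ≤
      5 / (p * fibZ p) * ∏ q ∈ s, ((Nat.gcd q (fibZ p) : ℝ) / q) := by
  set z := fibZ p
  set m := ∏ q ∈ s, q
  have hm : 0 < m := Finset.prod_pos fun q hq => (hs q hq).pos
  have hpm : 0 < p * m := Nat.mul_pos hp.pos hm
  have hz : 0 < z := (fibZ_spec_s2 hp.pos).1
  have hdvd : Nat.lcm (p * m) z ∣ fibL (p * m) := by
    refine Nat.lcm_dvd (Nat.dvd_lcm_left _ _) (dvd_trans ?_ (Nat.dvd_lcm_right _ _))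
    rw [fibZ_dvd_iff hp.pos]
    exact (Nat.dvd_mul_right _ _).trans (fibZ_spec_s2 hpm).2
  have hgcd : Nat.gcd (p * m) z ≤ 5 * ∏ q ∈ s, Nat.gcd q z := by
    have hpos : 0 < ∏ q ∈ s, Nat.gcd q z := Finset.prod_pos fun _ _ => Nat.gcd_pos_of_pos_right _ hz
    calc Nat.gcd (p * m) z ≤ Nat.gcd p z * Nat.gcd m z :=
          Nat.le_of_dvd (Nat.mul_pos (Nat.gcd_pos_of_pos_right _ hz) (Nat.gcd_pos_of_pos_right _ hz))
            (Nat.gcd_mul_left_dvd_mul_gcd _ _ _)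
      _ ≤ _ := Nat.mul_le_mul (gcd_prime_fibZ_le hp)
            (Nat.le_of_dvd hpos (gcd_prod_dvd_prod_gcd s z))
  have hlcm : (Nat.gcd (p * m) z : ℝ) * Nat.lcm (p * m) z = p * m * z := by
    exact_mod_cast Nat.gcd_mul_lcm (p * m) z
  have hlpos : (0 : ℝ) < Nat.lcm (p * m) z := by exact_mod_cast Nat.lcm_pos hpm hz
  have hm' : (0 : ℝ) < m := by exact_mod_cast hm
  have hp' : (0 : ℝ) < p := by exact_mod_cast hp.pos
  have hz' : (0 : ℝ) < z := by exact_mod_cast hz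
  calc 1 / (fibL (p * m) : ℝ) ≤ 1 / (Nat.lcm (p * m) z : ℝ) :=
        one_div_le_one_div_of_le hlpos (by exact_mod_cast Nat.le_of_dvd (fibL_pos hpm) hdvd)
    _ = (Nat.gcd (p * m) z : ℝ) / (p * m * z) := by
        rw [div_eq_div_iff hlpos.ne' (by positivity), one_mul, hlcm]
    _ ≤ ((5 * ∏ q ∈ s, Nat.gcd q z : ℕ) : ℝ) / (p * m * z) := by gcongr
    _ = _ := by
        have hprod : ∏ q ∈ s, (q : ℝ) = m := (Nat.cast_prod _ _).symm
        rw [Finset.prod_div_distrib, hprod]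
        push_cast
        field_simp

theorem prod_one_add_gcd_div_le (n : ℕ) {z : ℕ} (hz : z ≠ 0) :
    ∏ q ∈ Nat.primesBelow n, (1 + (Nat.gcd q z : ℝ) / q) ≤
      (∏ q ∈ Nat.primesBelow n, (1 + 1 / (q : ℝ))) * (4 * √z) := by
  refine le_trans ?_ (mul_le_mul_of_nonneg_left (two_pow_card_primeFactors_le_sqrt hz)
    (Finset.prod_nonneg fun _ _ => by positivity))
  calc ∏ q ∈ Nat.primesBelow n, (1 + (Nat.gcd q z : ℝ) / q)
      ≤ ∏ q ∈ Nat.primesBelow n, ((1 + 1 / (q : ℝ)) * if q ∣ z then 2 else 1) := by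
        refine Finset.prod_le_prod (fun _ _ => by positivity) fun q hq => ?_
        have hqp := (Nat.mem_primesBelow.1 hq).2
        have hq0 : (q : ℝ) ≠ 0 := by exact_mod_cast hqp.ne_zero
        split_ifs with h
        · rw [Nat.gcd_eq_left h, div_self hq0]
          have : 0 ≤ 1 / (q : ℝ) := by positivity
          linarith
        · rw [(hqp.coprime_iff_not_dvd.2 h).gcd_eq_one]
          simp
    _ = (∏ q ∈ Nat.primesBelow n, (1 + 1 / (q : ℝ))) *
          2 ^ ((Nat.primesBelow n).filter (· ∣ z)).card := by
        rw [Finset.prod_mul_distrib, ← Finset.prod_filter, Finset.prod_const]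
    _ ≤ _ := by
        refine mul_le_mul_of_nonneg_left (pow_le_pow_right₀ (by norm_num) ?_)
          (Finset.prod_nonneg fun _ _ => by positivity)
        refine Finset.card_le_card fun q hq => ?_
        obtain ⟨h1, h2⟩ := Finset.mem_filter.1 hq
        exact Nat.mem_primeFactors.2 ⟨(Nat.mem_primesBelow.1 h1).2, h2, hz⟩

/-- The sum of `1 / ℓ(d)` over squarefree `d` with largest prime factor `p`. -/
theorem exists_sum_one_div_fibL_mul_prod_le :
    ∃ C : ℝ, 0 < C ∧ ∀ p : ℕ, p.Prime →
      ∑ s ∈ (Nat.primesBelow p).powerset, 1 / (fibL (p * ∏ q ∈ s, q) : ℝ) ≤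
        C * ((p : ℝ) ^ (-(7 / 8) : ℝ) * (fibZ p : ℝ) ^ (-(1 / 2) : ℝ)) := by
  obtain ⟨C, hC, h⟩ := exists_prod_primesBelow_le
  refine ⟨20 * C, by positivity, fun p hp => ?_⟩
  have hz := (fibZ_spec_s2 hp.pos).1
  set z := fibZ p
  have hp' : (0 : ℝ) < p := by exact_mod_cast hp.pos
  have hz' : (0 : ℝ) < z := by exact_mod_cast hz
  calc ∑ s ∈ (Nat.primesBelow p).powerset, 1 / (fibL (p * ∏ q ∈ s, q) : ℝ)
      ≤ ∑ s ∈ (Nat.primesBelow p).powerset,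
          5 / (p * z) * ∏ q ∈ s, ((Nat.gcd q z : ℝ) / q) :=
        Finset.sum_le_sum fun s hs => one_div_fibL_mul_prod_le hp fun q hq =>
          (Nat.mem_primesBelow.1 (Finset.mem_powerset.1 hs hq)).2
    _ = 5 / (p * z) * ∏ q ∈ Nat.primesBelow p, (1 + (Nat.gcd q z : ℝ) / q) := by
        rw [← Finset.mul_sum, Finset.prod_one_add]
    _ ≤ 5 / (p * z) * (C * (p : ℝ) ^ (1 / 8 : ℝ) * (4 * √z)) := by
        refine mul_le_mul_of_nonneg_left ?_ (by positivity)
        exact (prod_one_add_gcd_div_le p hz.ne').trans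
          (mul_le_mul_of_nonneg_right (h p hp.pos) (by positivity))
    _ = _ := by
        have h1 : (p : ℝ) ^ (-(7 / 8) : ℝ) = (p : ℝ) ^ (1 / 8 : ℝ) / p := by
          rw [← Real.rpow_sub_one hp'.ne']; norm_num
        have h2 : (z : ℝ) ^ (-(1 / 2) : ℝ) = √z / z := by
          rw [Real.sqrt_eq_rpow, ← Real.rpow_sub_one hz'.ne']; norm_num
        rw [h1, h2]
        ring

theorem sum_fibZ_rpow_le {T : Finset ℕ} (hT : ∀ p ∈ T, p.Prime) :
    ∑ p ∈ T, (fibZ p : ℝ) ^ (-(9 / 4) : ℝ) ≤ ∑' n : ℕ, (n : ℝ) ^ (-(5 / 4) : ℝ) := by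
  rw [Finset.sum_comp (fun n : ℕ => (n : ℝ) ^ (-(9 / 4) : ℝ)) fibZ]
  refine le_trans (Finset.sum_le_sum fun n hn => ?_)
    ((Real.summable_nat_rpow.2 (by norm_num)).sum_le_tsum (T.image fibZ)
      fun _ _ => by positivity)
  obtain ⟨p, hp, rfl⟩ := Finset.mem_image.1 hn
  have hz := (fibZ_spec_s2 (hT p hp).pos).1
  have hz' : (0 : ℝ) < fibZ p := by exact_mod_cast hz
  have hcard := card_le_of_fibZ_eq (S := T.filter (fibZ · = fibZ p)) hz.ne' fun q hq =>
    ⟨hT q (Finset.mem_filter.1 hq).1, (Finset.mem_filter.1 hq).2⟩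
  rw [nsmul_eq_mul]
  calc _ ≤ (fibZ p : ℝ) * (fibZ p : ℝ) ^ (-(9 / 4) : ℝ) :=
        mul_le_mul_of_nonneg_right (by exact_mod_cast hcard) (by positivity)
    _ = _ := by rw [← Real.rpow_one_add' hz'.le (by norm_num)]; norm_num

theorem rpow_mul_rpow_le_add {p z : ℝ} (hp : 0 < p) (hz : 0 < z) :
    p ^ (-(7 / 8) : ℝ) * z ^ (-(1 / 2) : ℝ) ≤ p ^ (-(9 / 8) : ℝ) + z ^ (-(9 / 4) : ℝ) := by
  rcases le_total p (z ^ 2) with h | h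
  · have h1 : z ^ (-(1 / 2) : ℝ) ≤ p ^ (-(1 / 4) : ℝ) := by
      calc z ^ (-(1 / 2) : ℝ) = (z ^ 2) ^ (-(1 / 4) : ℝ) := by
            rw [← Real.rpow_natCast, ← Real.rpow_mul hz.le]; norm_num
        _ ≤ _ := Real.rpow_le_rpow_of_nonpos hp h (by norm_num)
    have h2 : p ^ (-(7 / 8) : ℝ) * p ^ (-(1 / 4) : ℝ) = p ^ (-(9 / 8) : ℝ) := by
      rw [← Real.rpow_add hp]; norm_num
    have h3 : 0 < z ^ (-(9 / 4) : ℝ) := by positivity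
    have := mul_le_mul_of_nonneg_left h1 (by positivity : 0 ≤ p ^ (-(7 / 8) : ℝ))
    linarith
  · have h1 : p ^ (-(7 / 8) : ℝ) ≤ z ^ (-(7 / 4) : ℝ) := by
      calc p ^ (-(7 / 8) : ℝ) ≤ (z ^ 2) ^ (-(7 / 8) : ℝ) :=
            Real.rpow_le_rpow_of_nonpos (by positivity) h (by norm_num)
        _ = _ := by rw [← Real.rpow_natCast, ← Real.rpow_mul hz.le]; norm_num
    have h2 : z ^ (-(7 / 4) : ℝ) * z ^ (-(1 / 2) : ℝ) = z ^ (-(9 / 4) : ℝ) := by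
      rw [← Real.rpow_add hz]; norm_num
    have h3 : 0 < p ^ (-(9 / 8) : ℝ) := by positivity
    have := mul_le_mul_of_nonneg_right h1 (by positivity : 0 ≤ z ^ (-(1 / 2) : ℝ))
    linarith

theorem exists_sum_prime_rpow_mul_fibZ_rpow_le :
    ∃ K : ℝ, ∀ T : Finset ℕ, (∀ p ∈ T, p.Prime) →
      ∑ p ∈ T, (p : ℝ) ^ (-(7 / 8) : ℝ) * (fibZ p : ℝ) ^ (-(1 / 2) : ℝ) ≤ K := by
  refine ⟨∑' n : ℕ, (n : ℝ) ^ (-(9 / 8) : ℝ) + ∑' n : ℕ, (n : ℝ) ^ (-(5 / 4) : ℝ), fun T hT => ?_⟩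
  calc _ ≤ ∑ p ∈ T, ((p : ℝ) ^ (-(9 / 8) : ℝ) + (fibZ p : ℝ) ^ (-(9 / 4) : ℝ)) :=
        Finset.sum_le_sum fun p hp => rpow_mul_rpow_le_add
          (by exact_mod_cast (hT p hp).pos) (by exact_mod_cast (fibZ_spec_s2 (hT p hp).pos).1)
    _ ≤ _ := by
        rw [Finset.sum_add_distrib]
        exact add_le_add ((Real.summable_nat_rpow.2 (by norm_num)).sum_le_tsum T
          fun _ _ => by positivity) (sum_fibZ_rpow_le hT)

theorem sum_powerset_primesBelow (f : ℕ → ℝ) (N : ℕ) :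
    ∑ s ∈ (Nat.primesBelow N).powerset, f (∏ q ∈ s, q) =
      f 1 + ∑ p ∈ Nat.primesBelow N,
        ∑ s ∈ (Nat.primesBelow p).powerset, f (p * ∏ q ∈ s, q) := by
  induction N with
  | zero => simp
  | succ N ih =>
    rw [Nat.primesBelow_succ]
    split_ifs with hN
    · have hmem := Nat.notMem_primesBelow N
      rw [Finset.sum_powerset_insert hmem, Finset.sum_insert hmem, ih]
      have : ∑ s ∈ (Nat.primesBelow N).powerset, f (∏ q ∈ insert N s, q) =
          ∑ s ∈ (Nat.primesBelow N).powerset, f (N * ∏ q ∈ s, q) :=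
        Finset.sum_congr rfl fun s hs => by
          rw [Finset.prod_insert fun h => hmem (Finset.mem_powerset.1 hs h)]
      rw [this]
      ring
    · exact ih

theorem sum_squarefree_le_sum_powerset {f : ℕ → ℝ} (hf : ∀ n, 0 ≤ f n) {u : Finset ℕ} {N : ℕ}
    (hu : ∀ d ∈ u, Squarefree d ∧ d < N) :
    ∑ d ∈ u, f d ≤ ∑ s ∈ (Nat.primesBelow N).powerset, f (∏ q ∈ s, q) := by
  have hprod : ∀ d ∈ u, ∏ q ∈ d.primeFactors, q = d := fun d hd =>
    Nat.prod_primeFactors_of_squarefree (hu d hd).1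
  have hinj : Set.InjOn Nat.primeFactors u := fun a ha b hb h => by
    rw [← hprod a ha, ← hprod b hb, h]
  calc ∑ d ∈ u, f d = ∑ d ∈ u, f (∏ q ∈ d.primeFactors, q) :=
        Finset.sum_congr rfl fun d hd => by rw [hprod d hd]
    _ = ∑ s ∈ u.image Nat.primeFactors, f (∏ q ∈ s, q) := by
        rw [Finset.sum_image hinj]
    _ ≤ _ := by
        refine Finset.sum_le_sum_of_subset_of_nonneg (fun s hs => ?_) fun _ _ _ => hf _
        obtain ⟨d, hd, rfl⟩ := Finset.mem_image.1 hs
        refine Finset.mem_powerset.2 fun q hq => Nat.mem_primesBelow.2 ⟨?_, ?_⟩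
        · exact (Nat.le_of_mem_primeFactors hq).trans_lt (hu d hd).2
        · exact Nat.prime_of_mem_primeFactors hq

theorem summable_abs_moebius_div_fibL :
    Summable fun d : ℕ => |(ArithmeticFunction.moebius d : ℝ)| / (fibL d : ℝ) := by
  obtain ⟨C, hC, h⟩ := exists_sum_one_div_fibL_mul_prod_le
  obtain ⟨K, hK⟩ := exists_sum_prime_rpow_mul_fibZ_rpow_le
  refine summable_of_sum_le (c := 1 / (fibL 1 : ℝ) + C * K) (fun d => by positivity) fun u => ?_
  obtain ⟨N, hN⟩ := u.exists_nat_subset_range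
  calc ∑ d ∈ u, |(ArithmeticFunction.moebius d : ℝ)| / (fibL d : ℝ)
      = ∑ d ∈ u with Squarefree d, 1 / (fibL d : ℝ) := by
        rw [Finset.sum_filter]
        refine Finset.sum_congr rfl fun d _ => ?_
        have := ArithmeticFunction.abs_moebius (n := d)
        rw [← Int.cast_abs, this]
        split_ifs <;> simp
    _ ≤ ∑ s ∈ (Nat.primesBelow N).powerset, 1 / (fibL (∏ q ∈ s, q) : ℝ) :=
        sum_squarefree_le_sum_powerset (f := fun d => 1 / (fibL d : ℝ)) (fun _ => by positivity)
          fun d hd => ⟨(Finset.mem_filter.1 hd).2,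
            Finset.mem_range.1 (hN (Finset.mem_filter.1 hd).1)⟩
    _ = 1 / (fibL 1 : ℝ) + ∑ p ∈ Nat.primesBelow N,
          ∑ s ∈ (Nat.primesBelow p).powerset, 1 / (fibL (p * ∏ q ∈ s, q) : ℝ) :=
        sum_powerset_primesBelow (fun d => 1 / (fibL d : ℝ)) N
    _ ≤ 1 / (fibL 1 : ℝ) + C * K := by
        have hprime : ∀ p ∈ Nat.primesBelow N, p.Prime := fun p hp => (Nat.mem_primesBelow.1 hp).2
        refine add_le_add le_rfl ((Finset.sum_le_sum fun p hp => h p (hprime p hp)).trans ?_)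
        rw [← Finset.mul_sum]
        exact mul_le_mul_of_nonneg_left (hK _ hprime) hC.le

theorem summable_abs_moebius_div_fibL_mul {k : ℕ} (hk : 0 < k) :
    Summable fun d : ℕ => |(ArithmeticFunction.moebius d : ℝ)| / (fibL (d * k) : ℝ) := by
  refine summable_abs_moebius_div_fibL.of_nonneg_of_le (fun d => by positivity) fun d => ?_
  rcases Nat.eq_zero_or_pos d with rfl | hd
  · simp
  · have hdk := Nat.mul_pos hd hk
    have h1 : (0 : ℝ) < fibL d := by exact_mod_cast fibL_pos hd
    have h2 : (fibL d : ℝ) ≤ fibL (d * k) := by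
      exact_mod_cast Nat.le_of_dvd (fibL_pos hdk) (fibL_dvd_fibL hdk (Nat.dvd_mul_right d k))
    gcongr

theorem sum_moebius_filter_mul_dvd {k g N : ℕ} (hk : 0 < k) (hg : 0 < g) (hN : g < N) :
    ∑ d ∈ (Finset.range N).filter (fun d => 0 < d ∧ d * k ∣ g), ArithmeticFunction.moebius d =
      if g = k then 1 else 0 := by
  by_cases hkg : k ∣ g
  · obtain ⟨m, rfl⟩ := hkg
    have hm : 0 < m := Nat.pos_of_mul_pos_left hg
    have hset : (Finset.range N).filter (fun d => 0 < d ∧ d * k ∣ k * m) = m.divisors := by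
      ext d
      rw [Finset.mem_filter, Finset.mem_range, Nat.mem_divisors, mul_comm d k,
        Nat.mul_dvd_mul_iff_left hk]
      refine ⟨fun h => ⟨h.2.2, hm.ne'⟩, fun h => ⟨?_, Nat.pos_of_dvd_of_pos h.1 hm, h.1⟩⟩
      exact ((Nat.le_of_dvd hm h.1).trans (Nat.le_mul_of_pos_left m hk)).trans_lt hN
    rw [hset, ← ArithmeticFunction.coe_mul_zeta_apply, ArithmeticFunction.moebius_mul_coe_zeta,
      ArithmeticFunction.one_apply]
    refine if_congr ?_ rfl rfl
    rw [Nat.mul_eq_left hk.ne']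
  · rw [if_neg fun h : g = k => hkg (h ▸ dvd_rfl), Finset.filter_false_of_mem, Finset.sum_empty]
    exact fun d _ h => hkg ((Nat.dvd_mul_left k d).trans h.2)

theorem countIn_eq_card (S : Set ℕ) [DecidablePred (· ∈ S)] {x : ℝ} (hx : 0 ≤ x) :
    countIn S x = ((Finset.Ioc 0 ⌊x⌋₊).filter (· ∈ S)).card := by
  rw [countIn, ← Set.ncard_coe_finset]
  congr 1
  ext n
  simp only [Set.mem_inter_iff, Set.mem_ofPred_eq, Finset.coe_filter, Finset.mem_Ioc,
    Nat.le_floor_iff hx, Nat.succ_le_iff]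
  tauto

theorem countIn_fibA_eq_tsum {k : ℕ} (hk : 0 < k) {x : ℝ} (hx : 0 ≤ x) :
    (countIn (fibA k) x : ℝ) =
      ∑' d : ℕ, (ArithmeticFunction.moebius d : ℝ) * (⌊(fibL (d * k) : ℝ)⁻¹ * x⌋₊ : ℝ) := by
  classical
  set X := ⌊x⌋₊
  have hfloor (m : ℕ) : ⌊(m : ℝ)⁻¹ * x⌋₊ = X / m := by
    rw [inv_mul_eq_div, Nat.floor_div_natCast]
  simp only [hfloor]
  rw [tsum_eq_sum (s := Finset.range (X + 1))]
  · rw [countIn_eq_card _ hx, Finset.card_filter]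
    push_cast
    have h1 (n : ℕ) (hn : n ∈ Finset.Ioc 0 X) : (if n ∈ fibA k then (1 : ℝ) else 0) =
        ∑ d ∈ Finset.range (X + 1),
          if 0 < d ∧ fibL (d * k) ∣ n then (ArithmeticFunction.moebius d : ℝ) else 0 := by
      obtain ⟨hn0, hnX⟩ := Finset.mem_Ioc.1 hn
      have hle : Nat.gcd n (Nat.fib n) < X + 1 :=
        Nat.lt_succ_of_le ((Nat.gcd_le_left _ hn0).trans hnX)
      have hs := sum_moebius_filter_mul_dvd hk (Nat.gcd_pos_of_pos_left (Nat.fib n) hn0) hle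
      have hiff : n ∈ fibA k ↔ Nat.gcd n (Nat.fib n) = k := ⟨fun h => h.2, fun h => ⟨hn0, h⟩⟩
      rw [if_congr hiff rfl rfl, ← Finset.sum_filter]
      have hs' := congrArg (Int.cast : ℤ → ℝ) hs
      push_cast at hs'
      rw [← hs']
      refine Finset.sum_congr (Finset.filter_congr fun d _ => and_congr_right fun hd => ?_)
        fun _ _ => rfl
      exact (fibL_dvd_iff (Nat.mul_pos hd hk) n).symm
    rw [Finset.sum_congr rfl h1, Finset.sum_comm]
    refine Finset.sum_congr rfl fun d _ => ?_
    rcases Nat.eq_zero_or_pos d with rfl | hd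
    · simp
    · simp only [hd, true_and]
      rw [← Finset.sum_filter, Finset.sum_const, nsmul_eq_mul, mul_comm,
        Nat.Ioc_filter_dvd_card_eq_div]
  · intro d hd
    rw [Finset.mem_range, not_lt] at hd
    have hd0 : 0 < d := by omega
    have hlt : X < fibL (d * k) := by
      have h1 : d ∣ fibL (d * k) := (Nat.dvd_mul_right d k).trans (Nat.dvd_lcm_left _ _)
      have := Nat.le_of_dvd (fibL_pos (Nat.mul_pos hd0 hk)) h1
      omega
    rw [Nat.div_eq_of_lt hlt]
    simp

theorem density_of_fibA_eq_tsum (k : ℕ) (hk : 0 < k) :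
    Summable (fun d : ℕ => (ArithmeticFunction.moebius d : ℝ) / (fibL (d * k) : ℝ)) ∧
      HasDensity (fibA k)
        (∑' d : ℕ, (ArithmeticFunction.moebius d : ℝ) / (fibL (d * k) : ℝ)) := by
  have hsum := summable_abs_moebius_div_fibL_mul hk
  refine ⟨Summable.of_abs (by simpa [abs_div] using hsum), ?_⟩
  have hlim : Filter.Tendsto (fun x : ℝ => ∑' d : ℕ, (ArithmeticFunction.moebius d : ℝ) *
      ((⌊(fibL (d * k) : ℝ)⁻¹ * x⌋₊ : ℝ) / x)) Filter.atTop
      (nhds (∑' d : ℕ, (ArithmeticFunction.moebius d : ℝ) * (fibL (d * k) : ℝ)⁻¹)) := by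
    refine tendsto_tsum_of_dominated_convergence hsum
      (fun d => (tendsto_nat_floor_mul_div_atTop (by positivity)).const_mul _) ?_
    filter_upwards [Filter.eventually_gt_atTop 0] with x hx d
    rw [norm_mul, Real.norm_eq_abs, Real.norm_eq_abs, div_eq_mul_inv |(ArithmeticFunction.moebius d : ℝ)|,
      abs_of_nonneg (by positivity : 0 ≤ (⌊(fibL (d * k) : ℝ)⁻¹ * x⌋₊ : ℝ) / x)]
    refine mul_le_mul_of_nonneg_left ?_ (abs_nonneg _)
    rw [div_le_iff₀ hx]
    exact Nat.floor_le (by positivity)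
  simp only [div_eq_mul_inv] at hlim ⊢
  refine hlim.congr' ?_
  filter_upwards [Filter.eventually_gt_atTop 0] with x hx
  rw [countIn_fibA_eq_tsum hk hx.le, div_eq_mul_inv, ← tsum_mul_right]
  simp only [mul_assoc]
end
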